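/- arXiv:0805.1381 — 3 statements merged into one kernel-verified Lean document; each statement's English description precedes it below -/
import Mathlib

section
/- Let (E, V, s, t, r) be a finite rooted oriented loopless multigraph, let G be its reduced Goeritz matrix, and let v be the signed-degree vector of the orientation. Then for every integer vector y indexed by the non-root vertices V' one has y·(G y) ≤ v·y. (This is the paper's claim that the inequality yᵀGy ≤ v·y holds when v is the vector induced by any orientation of the white graph W.) -/
open Matrix

/-- The reduced Goeritz matrix of a finite rooted oriented loopless multigraph
`(E, V, s, t, r)`: indexed by the non-root vertices, with off-diagonal entry the
number of edges joining the two vertices, and diagonal entry minus the number of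
incident edges. -/
def reducedGoeritz (E V : Type*) [Fintype E] [Fintype V] [DecidableEq V]
    (s t : E → V) (r : V) : Matrix {w : V // w ≠ r} {w : V // w ≠ r} ℤ :=
  Matrix.of fun u w =>
    if (u : V) = (w : V) then
      -((Finset.univ.filter fun e : E => s e = (u : V) ∨ t e = (u : V)).card : ℤ)
    else
      ((Finset.univ.filter fun e : E =>
        ({s e, t e} : Finset V) = {(u : V), (w : V)}).card : ℤ)

/-- The signed-degree vector of the orientation: `v w = #{e : s e = w} − #{e : t e = w}`. -/
def signedDegree (E V : Type*) [Fintype E] [Fintype V] [DecidableEq V]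
    (s t : E → V) (r : V) : {w : V // w ≠ r} → ℤ :=
  fun w => ((Finset.univ.filter fun e : E => s e = (w : V)).card : ℤ)
    - ((Finset.univ.filter fun e : E => t e = (w : V)).card : ℤ)

/-- The signed vertex-edge incidence matrix with the row of the root deleted. -/
def reducedIncidence {E V : Type*} [DecidableEq V] (s t : E → V) (r : V) :
    Matrix {w : V // w ≠ r} E ℤ :=
  Matrix.of fun w e => (if s e = (w : V) then 1 else 0) - (if t e = (w : V) then 1 else 0)

theorem signedDegree_eq_mulVec_one {E V : Type*} [Fintype E] [Fintype V] [DecidableEq V]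
    (s t : E → V) (r : V) :
    signedDegree E V s t r = reducedIncidence s t r *ᵥ 1 := by
  ext w
  simp [signedDegree, reducedIncidence, mulVec, dotProduct]

theorem reducedGoeritz_eq_neg_mul_transpose {E V : Type*} [Fintype E] [Fintype V]
    [DecidableEq V] (s t : E → V) (r : V) (hst : ∀ e, s e ≠ t e) :
    reducedGoeritz E V s t r = -(reducedIncidence s t r * (reducedIncidence s t r)ᵀ) := by
  ext u w
  simp only [reducedGoeritz, reducedIncidence, of_apply, neg_apply, mul_apply, transpose_apply,
    Finset.card_filter, Nat.cast_sum, ← Finset.sum_neg_distrib]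
  split_ifs with huw
  · refine Finset.sum_congr rfl fun e _ => ?_
    have := hst e
    grind
  · refine Finset.sum_congr rfl fun e _ => ?_
    have := hst e
    have hpair : (({s e, t e} : Finset V) = {(u : V), (w : V)}) ↔
        (s e = u ∧ t e = w) ∨ (s e = w ∧ t e = u) := by
      rw [← Finset.coe_inj]
      push_cast
      exact Set.pair_eq_pair_iff
    simp only [hpair]
    grind

/-- For a finite rooted oriented loopless multigraph with reduced
Goeritz matrix `G` and signed-degree vector `v`, every integer vector `y` indexed
by the non-root vertices satisfies `y ⬝ (G y) ≤ v ⬝ y`. -/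
theorem dot_reducedGoeritz_mulVec_le {E V : Type*} [Fintype E] [Fintype V] [DecidableEq V]
    (s t : E → V) (r : V) (hst : ∀ e, s e ≠ t e)
    (y : {w : V // w ≠ r} → ℤ) :
    y ⬝ᵥ (reducedGoeritz E V s t r *ᵥ y) ≤ signedDegree E V s t r ⬝ᵥ y := by
  rw [reducedGoeritz_eq_neg_mul_transpose s t r hst, signedDegree_eq_mulVec_one, neg_mulVec,
    dotProduct_neg, ← mulVec_mulVec, dotProduct_mulVec, mulVec_transpose, dotProduct_comm _ y,
    dotProduct_mulVec]
  simp only [dotProduct, Pi.one_apply, mul_one, ← Finset.sum_neg_distrib]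
  refine Finset.sum_le_sum fun e _ => ?_
  generalize (y ᵥ* reducedIncidence s t r) e = a
  rcases le_or_gt 0 a with ha | ha <;> nlinarith
end

section
/- Let E and V be finite types and let M be an E × V matrix with integer entries such that the matrix G := −MᵀM has nonzero determinant (so G is invertible over ℚ). Set v := Mᵀ𝟙, where 𝟙 is the all-ones integer vector indexed by E, and let q(u) := u·(G⁻¹ u) be the quadratic form over ℚ associated to G. Then for every integer vector y indexed by V, q(v − 2·(G y)) ≤ q(v); that is, v attains the maximum value of q over the coset {v − 2·(G y) : y an integer vector} of 2·im(G). -/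
open Matrix

/-- Expansion of the quadratic form of `A⁻¹` along a translate by `2 A y`. -/
theorem dotProduct_inv_mulVec_sub_two_smul {n K : Type*} [Fintype n] [DecidableEq n] [CommRing K]
    {A : Matrix n n K} (hA : A.IsSymm) (hdet : IsUnit A.det) (v y : n → K) :
    (v - (2 : K) • (A *ᵥ y)) ⬝ᵥ (A⁻¹ *ᵥ (v - (2 : K) • (A *ᵥ y)))
      = v ⬝ᵥ (A⁻¹ *ᵥ v) - 4 * (v ⬝ᵥ y - y ⬝ᵥ (A *ᵥ y)) := by
  have hinv : A⁻¹ *ᵥ (A *ᵥ y) = y := by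
    rw [mulVec_mulVec, nonsing_inv_mul A hdet, one_mulVec]
  have hcross : (A *ᵥ y) ⬝ᵥ (A⁻¹ *ᵥ v) = v ⬝ᵥ y := by
    rw [← vecMul_transpose, hA.eq, ← dotProduct_mulVec, mulVec_mulVec, mul_nonsing_inv A hdet,
      one_mulVec, dotProduct_comm]
  simp only [mulVec_sub, mulVec_smul, hinv, sub_dotProduct, dotProduct_sub, smul_dotProduct,
    dotProduct_smul, hcross, smul_eq_mul, dotProduct_comm (A *ᵥ y) y]
  ring

/-- With `z = M y`, this is `-∑ zₑ² ≤ ∑ zₑ`, which holds termwise over the integers. -/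
theorem dotProduct_neg_gram_mulVec_le {E V : Type*} [Fintype E] [Fintype V]
    (M : Matrix E V ℤ) (y : V → ℤ) :
    y ⬝ᵥ (-(Mᵀ * M) *ᵥ y) ≤ (Mᵀ *ᵥ fun _ => (1 : ℤ)) ⬝ᵥ y := by
  rw [neg_mulVec, dotProduct_neg, ← mulVec_mulVec, dotProduct_mulVec, vecMul_transpose,
    mulVec_transpose, ← dotProduct_mulVec]
  simp only [dotProduct, one_mul, ← Finset.sum_neg_distrib]
  refine Finset.sum_le_sum fun e _ => ?_
  rcases le_or_gt 0 ((M *ᵥ y) e) with h | h <;> nlinarith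

/-- For an integer matrix `M : E × V` such that `G := -MᵀM` has
nonzero determinant, the vector `v := Mᵀ𝟙` attains the maximum of the quadratic
form `q u := u ⬝ (G⁻¹ u)` (over `ℚ`) on its coset `{v - 2 G y : y integral}`:
`q (v - 2 G y) ≤ q v` for every integer vector `y`. -/
theorem quadForm_neg_gram_max_on_orbit {E V : Type*} [Fintype E] [Fintype V] [DecidableEq V]
    (M : Matrix E V ℤ) (hdet : (-(Mᵀ * M)).det ≠ 0) (y : V → ℤ) :
    ((fun i => (((Mᵀ *ᵥ fun _ => (1 : ℤ)) i : ℤ) : ℚ))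
        - (2 : ℚ) • (((-(Mᵀ * M)).map ((↑) : ℤ → ℚ)) *ᵥ fun i => ((y i : ℤ) : ℚ)))
      ⬝ᵥ ((((-(Mᵀ * M)).map ((↑) : ℤ → ℚ))⁻¹) *ᵥ
        ((fun i => (((Mᵀ *ᵥ fun _ => (1 : ℤ)) i : ℤ) : ℚ))
          - (2 : ℚ) • (((-(Mᵀ * M)).map ((↑) : ℤ → ℚ)) *ᵥ fun i => ((y i : ℤ) : ℚ))))
    ≤ (fun i => (((Mᵀ *ᵥ fun _ => (1 : ℤ)) i : ℤ) : ℚ))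
      ⬝ᵥ ((((-(Mᵀ * M)).map ((↑) : ℤ → ℚ))⁻¹) *ᵥ
        fun i => (((Mᵀ *ᵥ fun _ => (1 : ℤ)) i : ℤ) : ℚ)) := by
  have hsymm : ((-(Mᵀ * M)).map ((↑) : ℤ → ℚ)).IsSymm := by
    have hgram : (-(Mᵀ * M)).IsSymm := by
      rw [IsSymm, transpose_neg, transpose_mul, transpose_transpose]
    exact hgram.map _
  have hunit : IsUnit ((-(Mᵀ * M)).map ((↑) : ℤ → ℚ)).det := by
    have hcast : ((-(Mᵀ * M)).map ((↑) : ℤ → ℚ)).det = ((-(Mᵀ * M)).det : ℚ) :=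
      ((Int.castRingHom ℚ).map_det _).symm
    rw [hcast]
    exact isUnit_iff_ne_zero.mpr (Int.cast_ne_zero.mpr hdet)
  rw [dotProduct_inv_mulVec_sub_two_smul hsymm hunit]
  have hle : ((y ⬝ᵥ (-(Mᵀ * M) *ᵥ y) : ℤ) : ℚ) ≤ ((Mᵀ *ᵥ fun _ => (1 : ℤ)) ⬝ᵥ y : ℤ) :=
    Int.cast_le.mpr (dotProduct_neg_gram_mulVec_le M y)
  have hle' : (fun i => (y i : ℚ)) ⬝ᵥ ((-(Mᵀ * M)).map ((↑) : ℤ → ℚ) *ᵥ fun i => (y i : ℚ))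
      ≤ (fun i => (((Mᵀ *ᵥ fun _ => (1 : ℤ)) i : ℤ) : ℚ)) ⬝ᵥ fun i => (y i : ℚ) := by
    simpa only [dotProduct, mulVec, map_apply, Int.cast_sum, Int.cast_mul] using hle
  linarith
end

section
/- Let (E, V, s, t, r) be a finite rooted oriented loopless multigraph that is connected, meaning any two vertices of V are related by the equivalence relation generated by the relation 'u and w are the two endpoints of some edge e ∈ E'. Then the reduced Goeritz matrix G is negative definite: for every nonzero rational vector y indexed by the non-root vertices V', y·(G y) < 0. (This is the paper's assertion that the Goeritz matrix of the white graph of a connected alternating diagram is negative definite.) -/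
open Matrix

/-- Each entry of the reduced Goeritz matrix is minus the inner product of two columns of the
signed incidence matrix. -/
lemma reducedGoeritz_apply_eq_neg_sum {E V : Type*} [Fintype E] [Fintype V] [DecidableEq V]
    (s t : E → V) (r : V) (hst : ∀ e, s e ≠ t e) (u w : {w : V // w ≠ r}) :
    ((reducedGoeritz E V s t r u w : ℤ) : ℚ) =
      -∑ e, ((if s e = u then 1 else 0) - (if t e = u then 1 else 0)) *
        ((if s e = w then 1 else 0) - (if t e = w then 1 else 0)) := by
  simp only [reducedGoeritz, Matrix.of_apply]
  split_ifs with h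
  · push_cast [Finset.card_filter]
    rw [neg_inj]
    refine Finset.sum_congr rfl fun e _ => ?_
    have := hst e
    rw [← h]
    split_ifs <;> simp_all
  · push_cast [Finset.card_filter]
    rw [← Finset.sum_neg_distrib]
    refine Finset.sum_congr rfl fun e _ => ?_
    have he := hst e
    have key : (({s e, t e} : Finset V) = {(u : V), (w : V)}) ↔
        (s e = u ∧ t e = w) ∨ (s e = w ∧ t e = u) := by
      rw [← Finset.coe_inj]
      push_cast
      exact Set.pair_eq_pair_iff
    simp only [key]
    split_ifs <;> grind

/-- Pairing a row of the signed incidence matrix with `y` gives the difference, across the edge,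
of the extension of `y` by zero at the root. -/
lemma sum_incidence_mul_eq_sub {V : Type*} [Fintype V] [DecidableEq V] (r a b : V)
    (y : {w : V // w ≠ r} → ℚ) :
    ∑ u : {w : V // w ≠ r}, ((if a = u then 1 else 0) - (if b = u then 1 else 0)) * y u =
      (if h : a ≠ r then y ⟨a, h⟩ else 0) - (if h : b ≠ r then y ⟨b, h⟩ else 0) := by
  have key : ∀ c : V, ∑ u : {w : V // w ≠ r}, (if c = u then 1 else 0) * y u =
      if h : c ≠ r then y ⟨c, h⟩ else 0 := by
    intro c
    split_ifs with h
    · rw [Finset.sum_eq_single ⟨c, h⟩]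
      · simp
      · intro u _ hu
        rw [if_neg fun hc => hu (Subtype.ext hc.symm), zero_mul]
      · simp
    · refine Finset.sum_eq_zero fun u _ => ?_
      rw [if_neg fun hc : c = u => h (hc ▸ u.2), zero_mul]
  simp only [sub_mul, Finset.sum_sub_distrib, key]

/-- The quadratic form of the reduced Goeritz matrix is minus the Dirichlet energy of the
extension of `y` by zero at the root. -/
lemma dotProduct_reducedGoeritz_mulVec {E V : Type*} [Fintype E] [Fintype V] [DecidableEq V]
    (s t : E → V) (r : V) (hst : ∀ e, s e ≠ t e) (y : {w : V // w ≠ r} → ℚ) :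
    y ⬝ᵥ (((reducedGoeritz E V s t r).map ((↑) : ℤ → ℚ)) *ᵥ y) =
      -∑ e, ((if h : s e ≠ r then y ⟨s e, h⟩ else 0) -
        (if h : t e ≠ r then y ⟨t e, h⟩ else 0)) ^ 2 := by
  simp only [← sum_incidence_mul_eq_sub, dotProduct, mulVec, Matrix.map_apply,
    reducedGoeritz_apply_eq_neg_sum s t r hst, sq, Finset.sum_mul_sum]
  simp only [Finset.mul_sum, Finset.sum_mul, neg_mul, mul_neg, Finset.sum_neg_distrib]
  rw [neg_inj]
  conv_rhs => rw [Finset.sum_comm]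
  refine Finset.sum_congr rfl fun u _ => ?_
  conv_rhs => rw [Finset.sum_comm]
  exact Finset.sum_congr rfl fun w _ => Finset.sum_congr rfl fun e _ => by ring

/-- If the finite rooted oriented loopless multigraph is connected
(any two vertices are related by the equivalence relation generated by "being
the two endpoints of some edge"), then its reduced Goeritz matrix is negative
definite: `y ⬝ (G y) < 0` for every nonzero rational vector `y` indexed by the
non-root vertices. -/
theorem reducedGoeritz_negDef_of_connected
    {E V : Type*} [Fintype E] [Fintype V] [DecidableEq V]
    (s t : E → V) (r : V) (hst : ∀ e, s e ≠ t e)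
    (hconn : ∀ u w : V,
      Relation.EqvGen (fun a b => ∃ e : E, (s e = a ∧ t e = b) ∨ (s e = b ∧ t e = a)) u w)
    (y : {w : V // w ≠ r} → ℚ) (hy : y ≠ 0) :
    y ⬝ᵥ (((reducedGoeritz E V s t r).map ((↑) : ℤ → ℚ)) *ᵥ y) < 0 := by
  rw [dotProduct_reducedGoeritz_mulVec s t r hst, neg_lt_zero]
  set z : V → ℚ := fun v => if h : v ≠ r then y ⟨v, h⟩ else 0 with hz
  change 0 < ∑ e, (z (s e) - z (t e)) ^ 2
  refine (Finset.sum_nonneg fun e _ => sq_nonneg _).lt_of_ne' fun h0 => hy ?_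
  have hedge : ∀ e, z (s e) = z (t e) := fun e => by
    have := (Finset.sum_eq_zero_iff_of_nonneg fun e _ => sq_nonneg _).1 h0 e (Finset.mem_univ e)
    exact sub_eq_zero.1 (pow_eq_zero_iff two_ne_zero |>.1 this)
  have hconst : ∀ u w, z u = z w := fun u w => by
    induction hconn u w with
    | rel a b h =>
      obtain ⟨e, ⟨rfl, rfl⟩ | ⟨rfl, rfl⟩⟩ := h
      exacts [hedge e, (hedge e).symm]
    | refl a => rfl
    | symm a b _ ih => exact ih.symm
    | trans a b c _ _ ih₁ ih₂ => exact ih₁.trans ih₂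
  funext u
  simpa [hz, u.2] using hconst u r
end
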